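/- Let p be a prime and G ⊆ SL_p(F) an irreducible finite monomial p-group containing the cyclic permutation matrix P of order p, such that for every pair of elements of order dividing p their product also has order dividing p (weak property P₂ for k=1). Then every element of G has order dividing p, i.e., the exponent of G equals p. -/

import Mathlib

section CyclicMonomial

open scoped Fin.CommRing

/-- Powers of a monomial matrix supported on the cyclic permutation `j ↦ j + 1`. -/
theorem diagonal_mul_cyclic_pow {R : Type*} [CommRing R] {n : ℕ} [NeZero n] (d : Fin n → R)
    (m : ℕ) :
    (Matrix.diagonal d * Matrix.of fun i j : Fin n => if i = j + 1 then (1 : R) else 0) ^ m =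
      Matrix.of fun i j =>
        if i = j + (m : Fin n) then ∏ l ∈ Finset.range m, d (i - (l : Fin n)) else 0 := by
  induction m with
  | zero =>
    ext i j
    simp [Matrix.one_apply]
  | succ m ih =>
    ext i j
    rw [pow_succ, ih, Matrix.mul_apply, Finset.sum_eq_single (j + 1)]
    · simp only [Matrix.of_apply, Matrix.diagonal_mul, if_true, mul_one, Nat.cast_succ,
        Finset.prod_range_succ]
      have h : j + 1 + (m : Fin n) = j + ((m : Fin n) + 1) := by ring
      rw [h]
      split_ifs with hi
      · rw [show i - (m : Fin n) = j + 1 by rw [hi]; ring]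
      · simp
    · intro b _ hb
      simp [Matrix.diagonal_mul, hb]
    · simp

/-- The `n`-th power of `D * P`, for `D` diagonal and `P` the cyclic permutation matrix of
size `n`, is the scalar matrix `det D`. -/
theorem diagonal_mul_cyclic_pow_card {R : Type*} [CommRing R] {n : ℕ} [NeZero n]
    (d : Fin n → R) :
    (Matrix.diagonal d * Matrix.of fun i j : Fin n => if i = j + 1 then (1 : R) else 0) ^ n =
      Matrix.diagonal fun _ => (Matrix.diagonal d).det := by
  rw [diagonal_mul_cyclic_pow]
  ext i j
  have hprod : ∏ l ∈ Finset.range n, d (i - (l : Fin n)) = ∏ l, d l := by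
    rw [← Fin.prod_univ_eq_prod_range (fun l => d (i - (l : Fin n))) n]
    simpa using Equiv.prod_comp (Equiv.subLeft i) d
  simp [Matrix.diagonal_apply, hprod]

end CyclicMonomial

/-- Let `p` be a prime and `G ⊆ SL_p(F)` an irreducible finite monomial
`p`-group containing the cyclic permutation matrix `P` of order `p` (every element is
diagonal or of the form `D P^k`, `1 ≤ k ≤ p - 1`, with `D` diagonal), all of whose
elements have determinant `1`, and suppose the product of any two elements of `G` of
order dividing `p` again has order dividing `p` (weak property P₂ for `k = 1`).  Then
every element of `G` has order dividing `p`, i.e. the exponent of `G` equals `p`. -/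
theorem stmt11 {F : Type*} [Field F] [IsAlgClosed F] [CharZero F]
    (p : ℕ) [Fact p.Prime]
    (G : Subgroup (GL (Fin p) F)) (hpG : IsPGroup p G) (hfin : Finite G)
    (hdet : ∀ g ∈ G, ((g : Matrix (Fin p) (Fin p) F)).det = 1)
    (P : Matrix (Fin p) (Fin p) F) (hP : P = Matrix.of fun i j => if i = j + 1 then 1 else 0)
    (hPmem : ∃ Pu : GL (Fin p) F, (Pu : Matrix (Fin p) (Fin p) F) = P ∧ Pu ∈ G)
    (hform : ∀ g ∈ G,
      (∃ d : Fin p → F, (g : Matrix (Fin p) (Fin p) F) = Matrix.diagonal d) ∨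
      (∃ (d : Fin p → F) (k : ℕ), 1 ≤ k ∧ k ≤ p - 1 ∧
        (g : Matrix (Fin p) (Fin p) F) = Matrix.diagonal d * P ^ k))
    (hirr : ∀ W : Submodule F (Fin p → F),
      (∀ g ∈ G, W.map (Matrix.mulVecLin (g : Matrix (Fin p) (Fin p) F)) ≤ W) →
      W = ⊥ ∨ W = ⊤)
    (hP2 : ∀ a b : GL (Fin p) F, a ∈ G → b ∈ G → a ^ p = 1 → b ^ p = 1 → (a * b) ^ p = 1) :
    (∀ g ∈ G, g ^ p = 1) ∧ Monoid.exponent G = p := by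
  have hp : p.Prime := Fact.out
  obtain ⟨Pu, hPu, hPG⟩ := hPmem
  have key : ∀ A ∈ G, (∃ d, (A : Matrix (Fin p) (Fin p) F) = Matrix.diagonal d) →
      (A * Pu) ^ p = 1 := by
    rintro A hA ⟨d, hd⟩
    have hdetd := hdet A hA
    rw [hd] at hdetd
    apply Units.ext
    rw [Units.val_pow_eq_pow_val, Units.val_mul, hPu, hP, hd, diagonal_mul_cyclic_pow_card,
      hdetd, Units.val_one, Matrix.diagonal_one]
  have hPp : Pu ^ p = 1 := by
    simpa using key 1 G.one_mem ⟨1, by simp [← Matrix.diagonal_one]⟩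
  have hdiag : ∀ A ∈ G, (∃ d, (A : Matrix (Fin p) (Fin p) F) = Matrix.diagonal d) →
      A ^ p = 1 := by
    intro A hA hd
    simpa using hP2 (A * Pu) Pu⁻¹ (G.mul_mem hA hPG) (G.inv_mem hPG) (key A hA hd)
      (by rw [inv_pow, hPp, inv_one])
  have hpow : ∀ g ∈ G, g ^ p = 1 := by
    intro g hg
    rcases hform g hg with hd | ⟨d, k, -, -, hgk⟩
    · exact hdiag g hg hd
    · have hkG : Pu ^ k ∈ G := G.pow_mem hPG k
      have hAG : g * (Pu ^ k)⁻¹ ∈ G := G.mul_mem hg (G.inv_mem hkG)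
      have hAd : ((g * (Pu ^ k)⁻¹ : GL (Fin p) F) : Matrix (Fin p) (Fin p) F) =
          Matrix.diagonal d := by
        rw [Units.val_mul, Units.mul_inv_eq_iff_eq_mul, hgk, Units.val_pow_eq_pow_val, hPu]
      simpa using hP2 _ (Pu ^ k) hAG hkG (hdiag _ hAG ⟨d, hAd⟩)
        (by rw [pow_right_comm, hPp, one_pow])
  refine ⟨hpow, ?_⟩
  have hdvd : Monoid.exponent G ∣ p :=
    Monoid.exponent_dvd_of_forall_pow_eq_one fun g => Subtype.ext (hpow g g.2)
  refine (hp.eq_one_or_self_of_dvd _ hdvd).resolve_left fun h1 => ?_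
  have hPu1 : Pu = 1 := by
    simpa [h1] using congrArg Subtype.val (Monoid.pow_exponent_eq_one (⟨Pu, hPG⟩ : G))
  have h00 := congrFun (congrFun (hP.symm.trans (hPu.symm.trans (congrArg Units.val hPu1))) 0) 0
  have h01 : (0 : Fin p) ≠ 1 := by
    intro h
    have h' := congrArg Fin.val h
    simp [Nat.mod_eq_of_lt hp.one_lt] at h'
  simp [h01] at h00
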